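/- For every b ∈ (0,1) there exists C such that for all Schwartz f on ℝ², (∫_{ℝ²} (∫_{ℝ²} |δ_α f(x)|² |α|^{−2−2b} dα)² dx)^{1/4} ≤ C ‖f‖_{Ḣ^{b+1/2}}. -/

import Mathlib

open MeasureTheory FourierTransform

/-- Square of the homogeneous Sobolev norm `‖g‖²_{Ḣ^s}` on `ℝ²`. -/
noncomputable def HsqNorm (s : ℝ) (g : EuclideanSpace ℝ (Fin 2) → ℂ) : ℝ :=
  ∫ ξ : EuclideanSpace ℝ (Fin 2), ‖ξ‖ ^ (2 * s) * ‖𝓕 g ξ‖ ^ 2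

open scoped ENNReal SchwartzMap

theorem lintegral_mul_sq_le {X : Type*} [MeasurableSpace X] {μ : Measure X} {f g : X → ℝ≥0∞}
    (hf : AEMeasurable f μ) (hg : AEMeasurable g μ) :
    (∫⁻ x, f x * g x ∂μ) ^ 2 ≤ (∫⁻ x, f x ^ 2 ∂μ) * ∫⁻ x, g x ^ 2 ∂μ := by
  have h := ENNReal.lintegral_mul_le_Lp_mul_Lq μ Real.HolderConjugate.two_two hf hg
  simp only [Pi.mul_apply, ENNReal.rpow_ofNat] at h
  calc _ ≤ ((∫⁻ x, f x ^ 2 ∂μ) ^ (1 / 2 : ℝ) * (∫⁻ x, g x ^ 2 ∂μ) ^ (1 / 2 : ℝ)) ^ 2 := by gcongr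
    _ = _ := by
      rw [mul_pow, ← ENNReal.rpow_mul_natCast, ← ENNReal.rpow_mul_natCast]
      norm_num

/-- Minkowski's integral inequality in `L²`. -/
theorem lintegral_lintegral_sq_le {X Y : Type*} [MeasurableSpace X] [MeasurableSpace Y]
    {μ : Measure X} {ν : Measure Y} [SFinite μ] [SFinite ν] {F : X → Y → ℝ≥0∞}
    (hF : Measurable (Function.uncurry F)) :
    ∫⁻ x, (∫⁻ y, F x y ∂ν) ^ 2 ∂μ ≤ (∫⁻ y, (∫⁻ x, F x y ^ 2 ∂μ) ^ (1 / 2 : ℝ) ∂ν) ^ 2 := by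
  have hx (x : X) : Measurable (F x) := hF.of_uncurry_left
  have hy (y : Y) : Measurable (fun x => F x y) := hF.of_uncurry_right
  have hint : Measurable fun x => ∫⁻ y, F x y ∂ν := hF.lintegral_prod_right
  have hnorm : Measurable fun y => (∫⁻ x, F x y ^ 2 ∂μ) ^ (1 / 2 : ℝ) :=
    ((hF.pow_const 2).lintegral_prod_left (f := fun x y => F x y ^ 2)).pow_const _
  have hcs (y z : Y) : ∫⁻ x, F x y * F x z ∂μ ≤
      (∫⁻ x, F x y ^ 2 ∂μ) ^ (1 / 2 : ℝ) * (∫⁻ x, F x z ^ 2 ∂μ) ^ (1 / 2 : ℝ) := by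
    have h := ENNReal.lintegral_mul_le_Lp_mul_Lq μ Real.HolderConjugate.two_two
      (hy y).aemeasurable (hy z).aemeasurable
    simpa only [Pi.mul_apply, ENNReal.rpow_ofNat] using h
  calc ∫⁻ x, (∫⁻ y, F x y ∂ν) ^ 2 ∂μ
      = ∫⁻ x, ∫⁻ y, F x y * ∫⁻ z, F x z ∂ν ∂ν ∂μ := by
        refine lintegral_congr fun x => ?_
        rw [lintegral_mul_const _ (hx x), sq]
    _ = ∫⁻ y, ∫⁻ x, F x y * ∫⁻ z, F x z ∂ν ∂μ ∂ν :=
        lintegral_lintegral_swap (hF.mul (hint.comp measurable_fst)).aemeasurable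
    _ = ∫⁻ y, ∫⁻ z, ∫⁻ x, F x y * F x z ∂μ ∂ν ∂ν := by
        refine lintegral_congr fun y => ?_
        rw [← lintegral_lintegral_swap (((hy y).comp measurable_fst).mul hF).aemeasurable]
        exact lintegral_congr fun x => (lintegral_const_mul _ (hx x)).symm
    _ ≤ ∫⁻ y, ∫⁻ z, (∫⁻ x, F x y ^ 2 ∂μ) ^ (1 / 2 : ℝ) *
          (∫⁻ x, F x z ^ 2 ∂μ) ^ (1 / 2 : ℝ) ∂ν ∂ν :=
        lintegral_mono fun y => lintegral_mono fun z => hcs y z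
    _ = _ := by
        simp_rw [lintegral_const_mul _ hnorm]
        rw [lintegral_mul_const _ hnorm, sq]

theorem lintegral_comp_smul_addHaar {E : Type*} [NormedAddCommGroup E] [NormedSpace ℝ E]
    [MeasurableSpace E] [BorelSpace E] [FiniteDimensional ℝ E] (μ : Measure E)
    [μ.IsAddHaarMeasure] (f : E → ℝ≥0∞) {r : ℝ} (hr : 0 < r) :
    ∫⁻ x, f x ∂μ = ENNReal.ofReal (r ^ Module.finrank ℝ E) * ∫⁻ x, f (r • x) ∂μ := by
  have h2 : ∫⁻ x, f (r • x) ∂μ = ∫⁻ x, f x ∂(μ.map (r • ·)) :=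
    (lintegral_map_equiv f (Homeomorph.smulOfNeZero (α := E) r hr.ne').toMeasurableEquiv).symm
  rw [h2, Measure.map_addHaar_smul μ hr.ne', lintegral_smul_measure, smul_eq_mul, ← mul_assoc,
    ← ENNReal.ofReal_mul (by positivity), abs_of_pos (by positivity),
    mul_inv_cancel₀ (by positivity), ENNReal.ofReal_one, one_mul]

local notation "Plane" => EuclideanSpace ℝ (Fin 2)

theorem lintegral_inv_norm_unit_lt_top :
    ∫⁻ x : Plane, (if ‖x‖ ≤ 1 then ENNReal.ofReal (‖x‖⁻¹) else 0) < ∞ := by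
  have h : IntegrableOn (fun x : Plane => ‖x‖⁻¹) (Metric.ball 0 2) := by
    rw [integrableOn_fun_norm_addHaar volume (f := fun y => y⁻¹)]
    have : IntegrableOn (fun _ : ℝ => (1 : ℝ)) (Set.Ioo 0 2) := by simp
    refine this.congr_fun (fun y hy => ?_) measurableSet_Ioo
    simp [hy.1.ne']
  have h2 := (h.mono_set (Metric.closedBall_subset_ball one_lt_two)).lintegral_lt_top
  rw [← lintegral_indicator measurableSet_closedBall] at h2
  refine lt_of_eq_of_lt (lintegral_congr fun x => ?_) h2
  simp [Set.indicator]

theorem lintegral_inv_norm_ball (r : ℝ) (hr : 0 ≤ r) :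
    ∫⁻ x : Plane, (if ‖x‖ ≤ r then ENNReal.ofReal (‖x‖⁻¹) else 0) = ENNReal.ofReal r *
    ∫⁻ x : Plane, (if ‖x‖ ≤ 1 then ENNReal.ofReal (‖x‖⁻¹) else 0) := by
  rcases hr.eq_or_lt with rfl | hr
  · simp +contextual
  rw [lintegral_comp_smul_addHaar volume _ hr, finrank_euclideanSpace_fin]
  have (x : Plane) : (if ‖r • x‖ ≤ r then ENNReal.ofReal (‖r • x‖⁻¹) else 0) =
      ENNReal.ofReal r⁻¹ * (if ‖x‖ ≤ 1 then ENNReal.ofReal (‖x‖⁻¹) else 0) := by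
    rw [norm_smul, Real.norm_of_nonneg hr.le, mul_inv, ENNReal.ofReal_mul (by positivity)]
    simp [mul_le_iff_le_one_right hr]
  simp_rw [this]
  rw [lintegral_const_mul' _ _ ENNReal.ofReal_ne_top, ← mul_assoc,
    ← ENNReal.ofReal_mul (by positivity)]
  congr 2
  field_simp

theorem lintegral_sq_le_of_le_convolution {a k : Plane → ℝ≥0∞} (ha : Measurable a)
    (hk : Measurable k) (hle : ∀ ξ, k ξ ≤ ∫⁻ η, a η * a (ξ - η)) (hfin : ∫⁻ ξ, k ξ ^ 2 ≠ ∞) :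
    ∫⁻ ξ, k ξ ^ 2 ≤ 4 * (∫⁻ x : Plane, (if ‖x‖ ≤ 1 then ENNReal.ofReal (‖x‖⁻¹) else 0)) *
      (∫⁻ η, ENNReal.ofReal ‖η‖ * a η ^ 2) ^ 2 := by
  set K := ∫⁻ x : Plane, (if ‖x‖ ≤ 1 then ENNReal.ofReal (‖x‖⁻¹) else 0)
  set A := ∫⁻ η, ENNReal.ofReal ‖η‖ * a η ^ 2
  set κ := ∫⁻ ξ, k ξ ^ 2
  let S : Set (Plane × Plane) := {p | ‖p.1‖ ≤ ‖p.2‖}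
  have hS : MeasurableSet S := measurableSet_le (by fun_prop) (by fun_prop)
  let T : Plane × Plane → ℝ≥0∞ := fun p => k (p.1 + p.2) * (a p.1 * a p.2)
  have hT : Measurable T := by fun_prop
  have hκ : κ ≤ ∫⁻ p, T p := by
    calc κ ≤ ∫⁻ ξ, ∫⁻ η, k ξ * (a η * a (ξ - η)) := by
          refine lintegral_mono fun ξ => ?_
          rw [lintegral_const_mul _ (by fun_prop), sq]
          gcongr
          exact hle ξ
      _ = ∫⁻ η, ∫⁻ ξ, k ξ * (a η * a (ξ - η)) :=
          lintegral_lintegral_swap (by fun_prop)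
      _ = ∫⁻ η, ∫⁻ ζ, T (η, ζ) := by
          refine lintegral_congr fun η => ?_
          rw [← lintegral_add_left_eq_self _ η]
          simp [T]
      _ = _ := (lintegral_prod _ hT.aemeasurable).symm
  have hsymm : ∫⁻ p in Sᶜ, T p ≤ ∫⁻ p in S, T p := by
    rw [← lintegral_indicator hS.compl, ← lintegral_indicator hS,
      Measure.volume_eq_prod, ← Measure.measurePreserving_swap.lintegral_comp (hT.indicator hS)]
    refine lintegral_mono fun p => ?_
    by_cases hp : ‖p.1‖ ≤ ‖p.2‖
    · simp [S, hp]
    · simp [Set.indicator, S, hp, (not_le.1 hp).le, T, mul_comm, add_comm]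
  let P : Plane × Plane → ℝ≥0∞ := fun p =>
    k (p.1 + p.2) * (ENNReal.ofReal ‖p.1‖ ^ (1 / 2 : ℝ) * a p.1)
  let Q : Plane × Plane → ℝ≥0∞ := fun p =>
    (if ‖p.1‖ ≤ ‖p.2‖ then ENNReal.ofReal ‖p.1‖⁻¹ else 0) ^ (1 / 2 : ℝ) * a p.2
  have hP : Measurable P := by fun_prop
  have hw : Measurable fun p : Plane × Plane =>
      if ‖p.1‖ ≤ ‖p.2‖ then ENNReal.ofReal ‖p.1‖⁻¹ else 0 :=
    Measurable.ite hS (by fun_prop) measurable_const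
  have hQ : Measurable Q := (hw.pow_const _).mul (by fun_prop)
  have hhalf (x : ℝ≥0∞) : (x ^ (1 / 2 : ℝ)) ^ 2 = x := by
    rw [← ENNReal.rpow_mul_natCast]; norm_num
  have hne : ∀ᵐ p : Plane × Plane, p.1 ≠ 0 :=
    Measure.quasiMeasurePreserving_fst.ae (Measure.ae_ne volume 0)
  have hPQ : ∫⁻ p in S, T p ≤ ∫⁻ p, P p * Q p := by
    rw [← lintegral_indicator hS]
    refine lintegral_mono_ae (hne.mono fun p hp => ?_)
    by_cases hpS : ‖p.1‖ ≤ ‖p.2‖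
    · have h1 : ENNReal.ofReal ‖p.1‖ ^ (1 / 2 : ℝ) * ENNReal.ofReal ‖p.1‖⁻¹ ^ (1 / 2 : ℝ) = 1 := by
        rw [← ENNReal.mul_rpow_of_nonneg _ _ (by norm_num), ← ENNReal.ofReal_mul (norm_nonneg _),
          mul_inv_cancel₀ (norm_ne_zero_iff.2 hp)]
        simp
      simp only [Set.indicator, S, Set.mem_ofPred_eq, hpS, if_true, T, P, Q]
      refine le_of_eq ?_
      calc _ = k (p.1 + p.2) * (a p.1 * a p.2) * 1 := (mul_one _).symm
        _ = _ := by rw [← h1]; ring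
    · simp [S, hpS]
  have hP2 : ∫⁻ p, P p ^ 2 = A * κ := by
    rw [Measure.volume_eq_prod, lintegral_prod _ (hP.pow_const 2).aemeasurable]
    simp only [P, mul_pow, hhalf]
    have (η : Plane) : ∫⁻ ζ, k (η + ζ) ^ 2 * (ENNReal.ofReal ‖η‖ * a η ^ 2) =
        κ * (ENNReal.ofReal ‖η‖ * a η ^ 2) := by
      rw [lintegral_mul_const _ (by fun_prop), lintegral_add_left_eq_self (fun ζ => k ζ ^ 2)]
    simp_rw [this]
    rw [lintegral_const_mul _ (by fun_prop), mul_comm]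
  have hQ2 : ∫⁻ p, Q p ^ 2 = K * A := by
    rw [Measure.volume_eq_prod, lintegral_prod_symm _ (hQ.pow_const 2).aemeasurable]
    simp only [Q, mul_pow, hhalf]
    have (ζ : Plane) : ∫⁻ η : Plane, (if ‖η‖ ≤ ‖ζ‖ then ENNReal.ofReal ‖η‖⁻¹ else 0) * a ζ ^ 2 =
        K * (ENNReal.ofReal ‖ζ‖ * a ζ ^ 2) := by
      rw [lintegral_mul_const _ (hw.of_uncurry_right (f := fun η ζ : Plane =>
        if ‖η‖ ≤ ‖ζ‖ then ENNReal.ofReal ‖η‖⁻¹ else 0)), lintegral_inv_norm_ball _ (norm_nonneg _)]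
      ring
    simp_rw [this]
    rw [lintegral_const_mul _ (by fun_prop)]
  have hκ2 : κ ^ 2 ≤ 4 * K * A ^ 2 * κ := by
    calc κ ^ 2 ≤ (2 * ∫⁻ p, P p * Q p) ^ 2 := by
          gcongr
          refine hκ.trans ?_
          rw [← lintegral_add_compl _ hS, two_mul]
          exact add_le_add hPQ (hsymm.trans hPQ)
      _ ≤ 2 ^ 2 * ((A * κ) * (K * A)) := by
          rw [mul_pow, ← hP2, ← hQ2]
          gcongr
          exact lintegral_mul_sq_le hP.aemeasurable hQ.aemeasurable
      _ = _ := by ring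
  rcases eq_or_ne κ 0 with h0 | h0
  · simp [h0]
  · rw [sq κ] at hκ2
    exact (ENNReal.mul_le_mul_iff_left h0 hfin).1 hκ2

theorem SchwartzMap.lintegral_enorm_sq (u : 𝓢(Plane, ℂ)) :
    ∫⁻ x, ‖u x‖ₑ ^ 2 = ENNReal.ofReal (∫ x, ‖u x‖ ^ 2) := by
  rw [ofReal_integral_eq_lintegral_ofReal ((u.memLp 2 volume).integrable_norm_pow two_ne_zero)
    (.of_forall fun x => by positivity)]
  simp [ENNReal.ofReal_pow]

/-- The embedding `Ḣ^{1/2} ↪ L⁴` on the plane, for the Fourier transform of a Schwartz function. -/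
theorem SchwartzMap.lintegral_fourier_pow_four_le (u : 𝓢(Plane, ℂ)) :
    ∫⁻ x, ‖𝓕 u x‖ₑ ^ 4 ≤
      4 * (∫⁻ x : Plane, (if ‖x‖ ≤ 1 then ENNReal.ofReal (‖x‖⁻¹) else 0)) *
        (∫⁻ ξ, ENNReal.ofReal ‖ξ‖ * ‖u ξ‖ₑ ^ 2) ^ 2 := by
  let c : 𝓢(Plane, ℂ) := SchwartzMap.convolution (ContinuousLinearMap.mul ℂ ℂ) u u
  have hc : ∫⁻ x, ‖𝓕 u x‖ₑ ^ 4 = ∫⁻ x, ‖c x‖ₑ ^ 2 := by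
    rw [c.lintegral_enorm_sq, ← SchwartzMap.integral_norm_sq_fourier c,
      ← SchwartzMap.lintegral_enorm_sq]
    refine lintegral_congr fun x => ?_
    simp only [c, SchwartzMap.fourier_convolution, SchwartzMap.pairing_apply_apply,
      ContinuousLinearMap.mul_apply', enorm_mul]
    ring
  rw [hc]
  refine lintegral_sq_le_of_le_convolution u.continuous.enorm.measurable
    c.continuous.enorm.measurable (fun ξ => ?_) ?_
  · rw [SchwartzMap.convolution_apply]
    refine (enorm_integral_le_lintegral_enorm _).trans_eq (lintegral_congr fun η => ?_)
    simp
  · rw [c.lintegral_enorm_sq]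
    exact ENNReal.ofReal_ne_top

theorem integrable_min_mul_norm_rpow {b : ℝ} (hb0 : 0 < b) (hb1 : b < 1) :
    Integrable fun x : Plane => min 4 ((2 * Real.pi * ‖x‖) ^ 2) * ‖x‖ ^ (-(2 + 2 * b)) := by
  rw [integrable_fun_norm_addHaar volume
    (f := fun y => min 4 ((2 * Real.pi * y) ^ 2) * y ^ (-(2 + 2 * b))),
    ← Set.Ioc_union_Ioi_eq_Ioi zero_le_one]
  simp only [finrank_euclideanSpace_fin, Nat.add_one_sub_one, pow_one, smul_eq_mul]
  have hm (s : Set ℝ) : AEStronglyMeasurable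
      (fun y : ℝ => y * (min 4 ((2 * Real.pi * y) ^ 2) * y ^ (-(2 + 2 * b))))
      (volume.restrict s) := by
    have : Measurable (fun y : ℝ => y * (min 4 ((2 * Real.pi * y) ^ 2) * y ^ (-(2 + 2 * b)))) := by
      fun_prop
    exact this.aestronglyMeasurable
  refine IntegrableOn.union ?_ ?_
  · have h : IntegrableOn (fun y : ℝ => (2 * Real.pi) ^ 2 * y ^ (1 - 2 * b)) (Set.Ioc 0 1) :=
      ((intervalIntegrable_iff_integrableOn_Ioc_of_le zero_le_one).1
        (intervalIntegral.intervalIntegrable_rpow' (by linarith))).const_mul _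
    refine Integrable.mono' h (hm _) ?_
    filter_upwards [ae_restrict_mem measurableSet_Ioc] with y hy
    have hy0 := hy.1
    rw [Real.norm_of_nonneg (by positivity)]
    calc _ ≤ y * ((2 * Real.pi * y) ^ 2 * y ^ (-(2 + 2 * b))) := by gcongr; exact min_le_right _ _
      _ = (2 * Real.pi) ^ 2 * (y ^ (3 : ℝ) * y ^ (-(2 + 2 * b))) := by norm_cast; ring
      _ = _ := by rw [← Real.rpow_add hy0]; ring_nf
  · have h : IntegrableOn (fun y : ℝ => 4 * y ^ (-1 - 2 * b)) (Set.Ioi 1) :=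
      (integrableOn_Ioi_rpow_of_lt (by linarith) one_pos).const_mul _
    refine Integrable.mono' h (hm _) ?_
    filter_upwards [ae_restrict_mem measurableSet_Ioi] with y hy
    have hy0 : 0 < y := one_pos.trans hy
    rw [Real.norm_of_nonneg (by positivity)]
    calc _ ≤ y * (4 * y ^ (-(2 + 2 * b))) := by gcongr; exact min_le_left _ _
      _ = 4 * (y ^ (1 : ℝ) * y ^ (-(2 + 2 * b))) := by rw [Real.rpow_one]; ring
      _ = _ := by rw [← Real.rpow_add hy0]; ring_nf

theorem norm_one_sub_fourierChar_sq_le (t : ℝ) :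
    ‖1 - (Real.fourierChar t : ℂ)‖ ^ 2 ≤ min 4 ((2 * Real.pi * |t|) ^ 2) := by
  refine le_min ?_ ?_
  · have : ‖1 - (Real.fourierChar t : ℂ)‖ ≤ 2 :=
      (norm_sub_le _ _).trans_eq (by rw [norm_one, Circle.norm_coe]; norm_num)
    nlinarith [norm_nonneg (1 - (Real.fourierChar t : ℂ))]
  · have : ‖1 - (Real.fourierChar t : ℂ)‖ ≤ 2 * Real.pi * |t| := by
      rw [norm_sub_rev, Real.fourierChar_apply, mul_comm _ Complex.I]
      refine (Real.norm_exp_I_mul_ofReal_sub_one_le (x := 2 * Real.pi * t)).trans_eq ?_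
      simp [abs_of_pos Real.pi_pos]
    gcongr

theorem lintegral_one_sub_fourierChar_le {b : ℝ} (ξ : Plane) :
    ∫⁻ α : Plane, ‖1 - (Real.fourierChar (inner ℝ α ξ) : ℂ)‖ₑ ^ 2 *
        ENNReal.ofReal (‖α‖ ^ (-(2 + 2 * b))) ≤
      (∫⁻ x : Plane, ENNReal.ofReal
        (min 4 ((2 * Real.pi * ‖x‖) ^ 2) * ‖x‖ ^ (-(2 + 2 * b)))) *
        ENNReal.ofReal (‖ξ‖ ^ (2 * b)) := by
  rcases eq_or_ne ξ 0 with rfl | hξ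
  · simp
  have hξ : 0 < ‖ξ‖ := norm_pos_iff.2 hξ
  rw [lintegral_comp_smul_addHaar volume _ (inv_pos.2 hξ), finrank_euclideanSpace_fin,
    ← lintegral_const_mul' _ _ ENNReal.ofReal_ne_top,
    ← lintegral_mul_const' _ _ ENNReal.ofReal_ne_top]
  refine lintegral_mono fun x => ?_
  rw [← ofReal_norm, ← ENNReal.ofReal_pow (norm_nonneg _), ← ENNReal.ofReal_mul (by positivity),
    ← ENNReal.ofReal_mul (by positivity), ← ENNReal.ofReal_mul (by positivity)]
  refine ENNReal.ofReal_le_ofReal ?_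
  have h1 : |inner ℝ (‖ξ‖⁻¹ • x) ξ| ≤ ‖x‖ := by
    refine (abs_real_inner_le_norm _ _).trans_eq ?_
    rw [norm_smul, norm_inv, norm_norm]
    field_simp
  have h2 : ‖ξ‖⁻¹ ^ 2 * ‖‖ξ‖⁻¹ • x‖ ^ (-(2 + 2 * b)) =
      ‖x‖ ^ (-(2 + 2 * b)) * ‖ξ‖ ^ (2 * b) := by
    rw [norm_smul, norm_inv, norm_norm, Real.mul_rpow (by positivity) (by positivity),
      Real.inv_rpow hξ.le, ← Real.rpow_neg hξ.le, neg_neg, Real.rpow_add hξ, Real.rpow_ofNat]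
    field_simp
  calc _ ≤ ‖ξ‖⁻¹ ^ 2 * (min 4 ((2 * Real.pi * |inner ℝ (‖ξ‖⁻¹ • x) ξ|) ^ 2) *
        ‖‖ξ‖⁻¹ • x‖ ^ (-(2 + 2 * b))) := by
        gcongr
        exact norm_one_sub_fourierChar_sq_le _
    _ ≤ ‖ξ‖⁻¹ ^ 2 * (min 4 ((2 * Real.pi * ‖x‖) ^ 2) *
        ‖‖ξ‖⁻¹ • x‖ ^ (-(2 + 2 * b))) := by gcongr
    _ = min 4 ((2 * Real.pi * ‖x‖) ^ 2) *
        (‖ξ‖⁻¹ ^ 2 * ‖‖ξ‖⁻¹ • x‖ ^ (-(2 + 2 * b))) := by ring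
    _ = _ := by rw [h2]; ring

theorem SchwartzMap.fourierInv_sub_compSubConst (f : 𝓢(Plane, ℂ)) (α ξ : Plane) :
    𝓕⁻ (f - f.compSubConstCLM ℂ α) ξ =
      (1 - (Real.fourierChar (inner ℝ α ξ) : ℂ)) * 𝓕⁻ f ξ := by
  have h : 𝓕⁻ (f.compSubConstCLM ℂ α) ξ = (Real.fourierChar (inner ℝ α ξ) : ℂ) * 𝓕⁻ f ξ := by
    rw [SchwartzMap.fourierInv_coe, SchwartzMap.fourierInv_coe, Real.fourierInv_eq,
      Real.fourierInv_eq, ← integral_add_right_eq_self _ α, ← integral_const_mul]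
    refine integral_congr_ae (.of_forall fun v => ?_)
    simp [inner_add_left, AddChar.map_add_eq_mul, Circle.smul_def]
    ring
  have hsub : 𝓕⁻ (f - f.compSubConstCLM ℂ α) = 𝓕⁻ f - 𝓕⁻ (f.compSubConstCLM ℂ α) :=
    map_sub (fourierInvCLM ℂ 𝓢(Plane, ℂ)) _ _
  rw [hsub, sub_apply, h]
  ring

theorem SchwartzMap.integrable_rpow_mul_norm_sq (u : 𝓢(Plane, ℂ)) {p : ℝ} (hp0 : 0 ≤ p)
    (hp : p ≤ 4) : Integrable fun ξ => ‖ξ‖ ^ p * ‖u ξ‖ ^ 2 := by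
  have hu (x : Plane) : ‖u x‖ ≤ SchwartzMap.seminorm ℝ 0 0 u := SchwartzMap.norm_le_seminorm ℝ u x
  refine Integrable.mono' (((u.integrable.norm).add (u.integrable_pow_mul volume 4)).const_mul
    (SchwartzMap.seminorm ℝ 0 0 u)) ?_ (.of_forall fun x => ?_)
  · have := u.continuous
    exact ((continuous_norm.rpow_const fun _ => Or.inr hp0).mul
      (this.norm.pow 2)).aestronglyMeasurable
  · rw [Real.norm_of_nonneg (by positivity)]
    have h1 : ‖x‖ ^ p ≤ 1 + ‖x‖ ^ 4 := by
      rcases le_total ‖x‖ 1 with h | h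
      · exact (Real.rpow_le_one (norm_nonneg _) h hp0).trans (by simp)
      · refine (Real.rpow_le_rpow_of_exponent_le h hp).trans ?_
        norm_cast
        simp
    calc ‖x‖ ^ p * ‖u x‖ ^ 2 = ‖x‖ ^ p * ‖u x‖ * ‖u x‖ := by ring
      _ ≤ (1 + ‖x‖ ^ 4) * ‖u x‖ * SchwartzMap.seminorm ℝ 0 0 u := by gcongr; exact hu x
      _ = _ := by simp only [Pi.add_apply]; ring

theorem HsqNorm_nonneg (s : ℝ) (g : Plane → ℂ) : 0 ≤ HsqNorm s g :=
  integral_nonneg fun ξ => by positivity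

theorem SchwartzMap.lintegral_rpow_mul_fourierInv (f : 𝓢(Plane, ℂ)) {s : ℝ} (hs0 : 0 ≤ s)
    (hs : s ≤ 2) :
    ∫⁻ ξ, ENNReal.ofReal (‖ξ‖ ^ (2 * s)) * ‖𝓕⁻ f ξ‖ₑ ^ 2 = ENNReal.ofReal (HsqNorm s f) := by
  rw [HsqNorm, ← SchwartzMap.fourier_coe, ofReal_integral_eq_lintegral_ofReal
    ((𝓕 f).integrable_rpow_mul_norm_sq (by linarith) (by linarith))
    (.of_forall fun x => by positivity), ← lintegral_neg_eq_self]
  refine lintegral_congr fun ξ => ?_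
  rw [SchwartzMap.fourierInv_coe, Real.fourierInv_eq_fourier_neg, norm_neg, neg_neg,
    ENNReal.ofReal_mul (by positivity), ENNReal.ofReal_pow (norm_nonneg _), ofReal_norm,
    SchwartzMap.fourier_coe]

theorem integral_le_toReal_lintegral {X : Type*} [MeasurableSpace X] {μ : Measure X} {g : X → ℝ}
    {G : X → ℝ≥0∞} (hg : ∀ x, 0 ≤ g x) (hgG : ∀ x, ENNReal.ofReal (g x) ≤ G x)
    (hG : ∫⁻ x, G x ∂μ ≠ ∞) : ∫ x, g x ∂μ ≤ (∫⁻ x, G x ∂μ).toReal := by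
  by_cases h : AEStronglyMeasurable g μ
  · rw [integral_eq_lintegral_of_nonneg_ae (.of_forall hg) h]
    exact ENNReal.toReal_mono hG (lintegral_mono hgG)
  · rw [integral_non_aestronglyMeasurable h]
    exact ENNReal.toReal_nonneg

theorem ofReal_integral_le_lintegral {X : Type*} [MeasurableSpace X] {μ : Measure X} {g : X → ℝ}
    {G : X → ℝ≥0∞} (hg : ∀ x, 0 ≤ g x) (hgG : ∀ x, ENNReal.ofReal (g x) ≤ G x) :
    ENNReal.ofReal (∫ x, g x ∂μ) ≤ ∫⁻ x, G x ∂μ := by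
  rcases eq_or_ne (∫⁻ x, G x ∂μ) ∞ with h | h
  · simp [h]
  · exact (ENNReal.ofReal_le_iff_le_toReal h).2 (integral_le_toReal_lintegral hg hgG h)

theorem lintegral_sq_difference_le {b : ℝ} (hb0 : 0 < b) (hb1 : b < 1) (f : 𝓢(Plane, ℂ)) :
    ∫⁻ x, (∫⁻ α : Plane, ‖f x - f (x - α)‖ₑ ^ 2 * ENNReal.ofReal (‖α‖ ^ (-(2 + 2 * b)))) ^ 2 ≤
      4 * (∫⁻ x : Plane, (if ‖x‖ ≤ 1 then ENNReal.ofReal (‖x‖⁻¹) else 0)) *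
        ((∫⁻ x : Plane, ENNReal.ofReal
          (min 4 ((2 * Real.pi * ‖x‖) ^ 2) * ‖x‖ ^ (-(2 + 2 * b)))) *
          ENNReal.ofReal (HsqNorm (b + 1 / 2) f)) ^ 2 := by
  set K := ∫⁻ x : Plane, (if ‖x‖ ≤ 1 then ENNReal.ofReal (‖x‖⁻¹) else 0)
  set M := ∫⁻ x : Plane, ENNReal.ofReal
    (min 4 ((2 * Real.pi * ‖x‖) ^ 2) * ‖x‖ ^ (-(2 + 2 * b)))
  let φ : Plane → ℝ≥0∞ := fun α => ENNReal.ofReal (‖α‖ ^ (-(2 + 2 * b)))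
  let m : Plane → Plane → ℝ≥0∞ := fun α ξ => ‖1 - (Real.fourierChar (inner ℝ α ξ) : ℂ)‖ₑ ^ 2
  let v : Plane → ℝ≥0∞ := fun ξ => ENNReal.ofReal ‖ξ‖ * ‖𝓕⁻ f ξ‖ₑ ^ 2
  have hf := f.continuous
  have hφ : Measurable φ := by fun_prop
  have hv : Measurable v := by
    have := (𝓕⁻ f).continuous
    fun_prop
  have hm : Measurable (Function.uncurry m) := by
    have : Continuous fun p : Plane × Plane => (Real.fourierChar (inner ℝ p.1 p.2) : ℂ) := by
      fun_prop
    exact (continuous_const.sub this).enorm.measurable.pow_const 2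
  have hL4 (α : Plane) : (∫⁻ x, (‖f x - f (x - α)‖ₑ ^ 2 * φ α) ^ 2) ^ (1 / 2 : ℝ) ≤
      (4 * K) ^ (1 / 2 : ℝ) * ∫⁻ ξ, v ξ * (m α ξ * φ α) := by
    have h := SchwartzMap.lintegral_fourier_pow_four_le (𝓕⁻ (f - f.compSubConstCLM ℂ α))
    rw [FourierTransform.fourier_fourierInv_eq] at h
    have hsq (x : ℝ≥0∞) : (x ^ 2) ^ (1 / 2 : ℝ) = x := by
      rw [← ENNReal.rpow_natCast_mul]; norm_num
    have hA : ∫⁻ ξ, v ξ * (m α ξ * φ α) =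
        (∫⁻ ξ, ENNReal.ofReal ‖ξ‖ * ‖𝓕⁻ (f - f.compSubConstCLM ℂ α) ξ‖ₑ ^ 2) * φ α := by
      rw [← lintegral_mul_const' _ _ ENNReal.ofReal_ne_top]
      refine lintegral_congr fun ξ => ?_
      rw [SchwartzMap.fourierInv_sub_compSubConst, enorm_mul]
      simp only [v, m]
      ring
    have hB : ∫⁻ x, (‖f x - f (x - α)‖ₑ ^ 2 * φ α) ^ 2 =
        (∫⁻ x, ‖(f - f.compSubConstCLM ℂ α) x‖ₑ ^ 4) * φ α ^ 2 := by
      rw [← lintegral_mul_const' _ _ (ENNReal.pow_ne_top ENNReal.ofReal_ne_top)]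
      refine lintegral_congr fun x => ?_
      rw [sub_apply, SchwartzMap.compSubConstCLM_apply]
      ring
    rw [hA, hB, ENNReal.mul_rpow_of_nonneg _ _ (by norm_num), hsq, ← mul_assoc]
    gcongr
    refine (ENNReal.rpow_le_rpow h (by norm_num)).trans_eq ?_
    rw [ENNReal.mul_rpow_of_nonneg _ _ (by norm_num), hsq]
  have hA : ∫⁻ α, ∫⁻ ξ, v ξ * (m α ξ * φ α) ≤ M * ENNReal.ofReal (HsqNorm (b + 1 / 2) f) := by
    have hmφ : Measurable (Function.uncurry fun α ξ => m α ξ * φ α) :=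
      hm.mul (hφ.comp measurable_fst)
    rw [lintegral_lintegral_swap ((hv.comp measurable_snd).mul hmφ).aemeasurable,
      ← f.lintegral_rpow_mul_fourierInv (by linarith) (by linarith)]
    have hfin : Measurable fun ξ => ENNReal.ofReal (‖ξ‖ ^ (2 * (b + 1 / 2))) * ‖𝓕⁻ f ξ‖ₑ ^ 2 := by
      have := (𝓕⁻ f).continuous
      fun_prop
    rw [← lintegral_const_mul _ hfin]
    refine lintegral_mono fun ξ => ?_
    rw [lintegral_const_mul _ hmφ.of_uncurry_right]
    refine (mul_le_mul_right (lintegral_one_sub_fourierChar_le ξ) _).trans_eq ?_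
    have hpow : ENNReal.ofReal (‖ξ‖ ^ (2 * (b + 1 / 2))) =
        ENNReal.ofReal ‖ξ‖ * ENNReal.ofReal (‖ξ‖ ^ (2 * b)) := by
      rw [← ENNReal.ofReal_mul (norm_nonneg _), ← Real.rpow_one_add' (norm_nonneg _) (by linarith)]
      ring_nf
    rw [hpow]
    simp only [v]
    ring
  have hF : Measurable (Function.uncurry fun x α => ‖f x - f (x - α)‖ₑ ^ 2 * φ α) := by
    have : Continuous fun p : Plane × Plane => f p.1 - f (p.1 - p.2) := by fun_prop
    exact (this.enorm.measurable.pow_const 2).mul (hφ.comp measurable_snd)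
  calc _ ≤ (∫⁻ α, (∫⁻ x, (‖f x - f (x - α)‖ₑ ^ 2 * φ α) ^ 2) ^ (1 / 2 : ℝ)) ^ 2 :=
        lintegral_lintegral_sq_le hF
    _ ≤ (∫⁻ α, (4 * K) ^ (1 / 2 : ℝ) * ∫⁻ ξ, v ξ * (m α ξ * φ α)) ^ 2 := by
        gcongr with α
        exact hL4 α
    _ = 4 * K * (∫⁻ α, ∫⁻ ξ, v ξ * (m α ξ * φ α)) ^ 2 := by
        rw [lintegral_const_mul _ (Measurable.lintegral_prod_right
          (f := fun α ξ => v ξ * (m α ξ * φ α))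
          ((hv.comp measurable_snd).mul (hm.mul (hφ.comp measurable_fst)))), mul_pow,
          ← ENNReal.rpow_mul_natCast]
        norm_num
    _ ≤ _ := by gcongr

theorem stmt_12 (b : ℝ) (hb0 : 0 < b) (hb1 : b < 1) :
    ∃ C : ℝ, 0 < C ∧ ∀ f : SchwartzMap (EuclideanSpace ℝ (Fin 2)) ℂ,
      (∫ x : EuclideanSpace ℝ (Fin 2),
          (∫ α : EuclideanSpace ℝ (Fin 2),
            ‖f x - f (x - α)‖ ^ 2 * ‖α‖ ^ (-(2 + 2 * b))) ^ 2) ^ ((1 : ℝ) / 4) ≤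
        C * (HsqNorm (b + 1 / 2) ⇑f) ^ ((1 : ℝ) / 2) := by
  have hK := lintegral_inv_norm_unit_lt_top.ne
  have hM := (integrable_min_mul_norm_rpow hb0 hb1).lintegral_lt_top.ne
  have hmain := fun f => lintegral_sq_difference_le hb0 hb1 f
  set K := ∫⁻ x : Plane, (if ‖x‖ ≤ 1 then ENNReal.ofReal (‖x‖⁻¹) else 0)
  set M := ∫⁻ x : Plane, ENNReal.ofReal
    (min 4 ((2 * Real.pi * ‖x‖) ^ 2) * ‖x‖ ^ (-(2 + 2 * b)))
  refine ⟨(4 * K.toReal * M.toReal ^ 2) ^ (1 / 4 : ℝ) + 1, by positivity, fun f => ?_⟩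
  have hH := HsqNorm_nonneg (b + 1 / 2) f
  have hR : 4 * K * (M * ENNReal.ofReal (HsqNorm (b + 1 / 2) f)) ^ 2 ≠ ∞ := by finiteness
  have hle : ∫ x, (∫ α, ‖f x - f (x - α)‖ ^ 2 * ‖α‖ ^ (-(2 + 2 * b))) ^ 2 ≤
      4 * K.toReal * (M.toReal * HsqNorm (b + 1 / 2) f) ^ 2 := by
    refine (integral_le_toReal_lintegral (fun x => by positivity) (fun x => ?_)
      (ne_top_of_le_ne_top hR (hmain f))).trans
        ((ENNReal.toReal_mono hR (hmain f)).trans_eq ?_)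
    · rw [ENNReal.ofReal_pow (integral_nonneg fun α => by positivity)]
      gcongr
      refine ofReal_integral_le_lintegral (fun α => by positivity) fun α => ?_
      rw [ENNReal.ofReal_mul (by positivity), ENNReal.ofReal_pow (norm_nonneg _), ofReal_norm]
    · simp only [ENNReal.toReal_mul, ENNReal.toReal_pow, ENNReal.toReal_ofReal hH,
        ENNReal.toReal_ofNat]
  calc _ ≤ (4 * K.toReal * (M.toReal * HsqNorm (b + 1 / 2) f) ^ 2) ^ (1 / 4 : ℝ) :=
        Real.rpow_le_rpow (integral_nonneg fun x => by positivity) hle (by norm_num)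
    _ = (4 * K.toReal * M.toReal ^ 2) ^ (1 / 4 : ℝ) * HsqNorm (b + 1 / 2) f ^ (1 / 2 : ℝ) := by
        rw [mul_pow, ← mul_assoc, Real.mul_rpow (by positivity) (by positivity),
          ← Real.rpow_natCast_mul hH]
        norm_num
    _ ≤ _ := by gcongr; simp
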